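/- If q is a polynomial of degree at most 2k−1 such that ⟨q, y^j⟩₁ = 0 for all 0 ≤ j ≤ 2k−1, then q = 0. -/

import Mathlib

open MeasureTheory Polynomial

/-- The skew-inner product `⟨f,g⟩₁ = ∬ f(x) g(y) ε(x−y) e^{−V(x)−V(y)} dx dy`. -/
noncomputable def skewInner (V f g : Polynomial ℝ) : ℝ :=
  ∫ p : ℝ × ℝ, f.eval p.1 * g.eval p.2 * Real.sign (p.1 - p.2) *
    Real.exp (-V.eval p.1 - V.eval p.2)


/-- Same sign on intervals avoiding `Z`. -/
def SignConst (Z : Finset ℝ) (f : ℝ → ℝ) : Prop :=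
  ∀ x y, x ≤ y → (∀ z ∈ Z, z ∉ Set.Icc x y) → 0 < f x * f y

lemma mul_pos_chain {a b c : ℝ} (h1 : 0 < a * b) (h2 : 0 < b * c) : 0 < a * c := by
  rcases mul_pos_iff.1 h1 with ⟨h, h'⟩ | ⟨h, h'⟩ <;> rcases mul_pos_iff.1 h2 with ⟨k, k'⟩ | ⟨k, k'⟩
  · positivity
  · linarith
  · linarith
  · exact mul_pos_of_neg_of_neg h k'

lemma signConst_merge {a L R : ℝ} {Z : Finset ℝ} {g : ℝ → ℝ}
    (hL : L < a) (hR : a < R) (hZ : ∀ z ∈ Z, z ∉ Set.Icc L R)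
    (hg : SignConst (insert a Z) g) (h1 : 0 < g L * g R) (h2 : 0 < g a * g R) :
    SignConst Z g := by
  intro x y hxy hz
  by_cases ha : a ∈ Set.Icc x y
  · obtain ⟨hxa, hay⟩ := ha
    have hx : 0 < g x * g R := by
      rcases hxa.eq_or_lt with rfl | hxa
      · exact h2
      · refine mul_pos_chain ?_ h1
        rcases le_total x L with h | h
        · apply hg x L h
          intro z hz'
          rcases Finset.mem_insert.1 hz' with rfl | hz'
          · simp only [Set.mem_Icc]; intro h; linarith [h.2]
          · intro h; exact hz z hz' ⟨h.1, by linarith [h.2]⟩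
        · rw [mul_comm]
          apply hg L x h
          intro z hz'
          rcases Finset.mem_insert.1 hz' with rfl | hz'
          · simp only [Set.mem_Icc]; intro h; linarith [h.2]
          · intro h; exact hZ z hz' ⟨h.1, by linarith [h.2]⟩
    refine mul_pos_chain hx ?_
    rcases hay.eq_or_lt with rfl | hay
    · rwa [mul_comm]
    · rcases le_total R y with h | h
      · apply hg R y h
        intro z hz'
        rcases Finset.mem_insert.1 hz' with rfl | hz'
        · simp only [Set.mem_Icc]; intro h; linarith [h.1]
        · intro h; exact hz z hz' ⟨by linarith [h.1], h.2⟩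
      · rw [mul_comm]
        apply hg y R h
        intro z hz'
        rcases Finset.mem_insert.1 hz' with rfl | hz'
        · simp only [Set.mem_Icc]; intro h; linarith [h.1]
        · intro h; exact hZ z hz' ⟨by linarith [h.1], h.2⟩
  · apply hg x y hxy
    intro z hz'
    rcases Finset.mem_insert.1 hz' with rfl | hz'
    · exact ha
    · exact hz z hz'

lemma exists_gap (a : ℝ) (Z : Finset ℝ) (ha : a ∉ Z) :
    ∃ L R, L < a ∧ a < R ∧ ∀ z ∈ Z, z ∉ Set.Icc L R := by
  have h : (↑Z : Set ℝ)ᶜ ∈ nhds a := Z.finite_toSet.isClosed.isOpen_compl.mem_nhds (by simpa using ha)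
  obtain ⟨ε, hε, hb⟩ := Metric.nhds_basis_closedBall.mem_iff.1 h
  refine ⟨a - ε, a + ε, by linarith, by linarith, fun z hz hz' => ?_⟩
  rw [Real.closedBall_eq_Icc] at hb
  exact hb hz' hz

lemma exists_sign_poly (Z : Finset ℝ) : ∀ f : ℝ → ℝ, SignConst Z f →
    ∃ S ⊆ Z, ∃ s : ℝ, ∀ x ∉ Z, 0 < s * f x * ∏ z ∈ S, (x - z) := by
  induction Z using Finset.induction_on with
  | empty =>
    intro f hf
    refine ⟨∅, by simp, f 0, fun x _ => ?_⟩
    simp only [Finset.prod_empty, mul_one]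
    rcases le_total 0 x with h | h
    · exact hf 0 x h (by simp)
    · rw [mul_comm]; exact hf x 0 h (by simp)
  | insert a Z ha ih =>
    intro f hf
    obtain ⟨L, R, hL, hR, hZ⟩ := exists_gap a Z ha
    have hLL := hf L L le_rfl (by
      intro z hz h
      have : z = L := le_antisymm h.2 h.1
      subst this
      rcases Finset.mem_insert.1 hz with rfl | hz
      · exact lt_irrefl _ hL
      · exact hZ z hz ⟨le_rfl, by linarith⟩)
    have hRR := hf R R le_rfl (by
      intro z hz h
      have : z = R := le_antisymm h.2 h.1
      subst this
      rcases Finset.mem_insert.1 hz with rfl | hz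
      · exact lt_irrefl _ hR
      · exact hZ z hz ⟨by linarith, le_rfl⟩)
    have hL0 : f L ≠ 0 := fun h => by simp [h] at hLL
    have hR0 : f R ≠ 0 := fun h => by simp [h] at hRR
    rcases (mul_ne_zero hL0 hR0).lt_or_gt with hneg | hpos
    · have hg : SignConst Z (Function.update (fun x => f x * (x - a)) a (f R)) := by
        refine signConst_merge hL hR hZ ?_ ?_ ?_
        · intro x y hxy hz
          have hxa : a ∉ Set.Icc x y := hz a (by simp)
          have h1 : x ≠ a := by rintro rfl; exact hxa ⟨le_rfl, hxy⟩
          have h2 : y ≠ a := by rintro rfl; exact hxa ⟨hxy, le_rfl⟩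
          rw [Function.update_of_ne h1, Function.update_of_ne h2]
          have h3 := hf x y hxy hz
          have : 0 < (x - a) * (y - a) := by
            by_cases h : x < a
            · have : y < a := by
                by_contra h'
                exact hxa ⟨h.le, not_lt.1 h'⟩
              nlinarith
            · have : a < x := lt_of_le_of_ne (not_lt.1 h) h1.symm
              nlinarith
          nlinarith [mul_pos h3 this]
        · rw [Function.update_of_ne hL.ne, Function.update_of_ne hR.ne']
          have : 0 < (a - L) * (R - a) := mul_pos (by linarith) (by linarith)
          nlinarith [mul_pos (neg_pos.2 hneg) this]
        · rw [Function.update_self, Function.update_of_ne hR.ne']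
          nlinarith [mul_pos hRR (sub_pos.2 hR)]
      obtain ⟨S, hS, s, hs⟩ := ih _ hg
      refine ⟨insert a S, Finset.insert_subset_insert _ hS, s, fun x hx => ?_⟩
      simp only [Finset.mem_insert, not_or] at hx
      have := hs x hx.2
      rw [Function.update_of_ne hx.1] at this
      rw [Finset.prod_insert (fun h => ha (hS h))]
      linarith
    · have hg : SignConst Z (Function.update f a (f R)) := by
        refine signConst_merge hL hR hZ ?_ ?_ ?_
        · intro x y hxy hz
          have hxa : a ∉ Set.Icc x y := hz a (by simp)
          have h1 : x ≠ a := by rintro rfl; exact hxa ⟨le_rfl, hxy⟩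
          have h2 : y ≠ a := by rintro rfl; exact hxa ⟨hxy, le_rfl⟩
          rw [Function.update_of_ne h1, Function.update_of_ne h2]
          exact hf x y hxy hz
        · rwa [Function.update_of_ne hL.ne, Function.update_of_ne hR.ne']
        · rwa [Function.update_self, Function.update_of_ne hR.ne']
      obtain ⟨S, hS, s, hs⟩ := ih _ hg
      refine ⟨S, hS.trans (Finset.subset_insert _ _), s, fun x hx => ?_⟩
      simp only [Finset.mem_insert, not_or] at hx
      have := hs x hx.2
      rwa [Function.update_of_ne hx.1] at this

lemma signConst_of_continuous {f : ℝ → ℝ} (hf : Continuous f) (Z : Finset ℝ)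
    (hZ : ∀ x, x ∈ Z ↔ f x = 0) : SignConst Z f := by
  intro x y hxy hz
  by_contra hneg
  have hx : f x ≠ 0 := fun h => hz x ((hZ x).2 h) ⟨le_rfl, hxy⟩
  have hy : f y ≠ 0 := fun h => hz y ((hZ y).2 h) ⟨hxy, le_rfl⟩
  have hlt : f x * f y < 0 := lt_of_le_of_ne (not_lt.1 hneg) (mul_ne_zero hx hy)
  rcases mul_neg_iff.1 hlt with ⟨h, h'⟩ | ⟨h, h'⟩
  · obtain ⟨c, hc, h0⟩ := intermediate_value_Icc' hxy hf.continuousOn ⟨h'.le, h.le⟩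
    exact hz c ((hZ c).2 h0) hc
  · obtain ⟨c, hc, h0⟩ := intermediate_value_Icc hxy hf.continuousOn ⟨h.le, h'.le⟩
    exact hz c ((hZ c).2 h0) hc

open Filter Topology in
lemma integrableOn_Ioi_poly (W p : ℝ[X]) (hdeg : 2 ≤ W.natDegree) (hlc : 0 < W.leadingCoeff) :
    IntegrableOn (fun x => p.eval x * Real.exp (-W.eval x)) (Set.Ioi 0) := by
  refine integrable_of_isBigO_exp_neg (b := 1) one_pos (by fun_prop) ?_
  have hd : (C (2:ℝ) * X : ℝ[X]).natDegree < W.natDegree :=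
    lt_of_le_of_lt (natDegree_C_mul_X (2:ℝ) two_ne_zero).le (by omega)
  have h1 : Tendsto (fun x => (W - C 2 * X).eval x) atTop atTop := by
    apply tendsto_atTop_of_leadingCoeff_nonneg
    · rw [← natDegree_pos_iff_degree_pos, natDegree_sub_eq_left_of_natDegree_lt hd]; omega
    · rw [leadingCoeff_sub_of_degree_lt (degree_lt_degree hd)]; exact hlc.le
  have h2 := (Real.tendsto_exp_neg_atTop_nhds_zero.comp h1).mul p.tendsto_div_exp_atTop
  have h3 := (h2.isBigO_one ℝ).mul (Asymptotics.isBigO_refl (fun x : ℝ => Real.exp (-1 * x)) atTop)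
  refine (h3.congr_left ?_).congr_right ?_
  · intro x
    simp only [Function.comp, div_eq_mul_inv, ← Real.exp_neg, eval_sub, eval_mul, eval_C, eval_X]
    rw [show -W.eval x = -(W.eval x - 2 * x) + -x + (-1 * x) by ring, Real.exp_add, Real.exp_add]
    ring
  · intro x; simp

lemma integrable_poly (V p : ℝ[X]) (hEven : Even V.natDegree) (hdeg : 2 ≤ V.natDegree)
    (hlc : 0 < V.leadingCoeff) :
    Integrable (fun x => p.eval x * Real.exp (-V.eval x)) := by
  have h1 := integrableOn_Ioi_poly V p hdeg hlc
  have h2 := integrableOn_Ioi_poly (V.comp (-X)) (p.comp (-X)) (by simpa [natDegree_comp] using hdeg)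
    (by rw [leadingCoeff_comp (by simp)]; simpa [hEven.neg_pow] using hlc)
  simp only [eval_comp, eval_neg, eval_X] at h2
  have h3 := integrableOn_Ici_iff_integrableOn_Ioi (μ := volume) (by finiteness) |>.mpr h2
  have h4 : IntegrableOn (fun x => p.eval x * Real.exp (-V.eval x)) (Set.Iic 0) := by
    rw [show (0:ℝ) = -0 by simp] at h3
    have := h3.comp_neg_Iic
    simpa using this
  rw [← integrableOn_univ, ← Set.Iic_union_Ioi (a := (0:ℝ))]
  exact h4.union h1

open Filter Topology in
/-- Antiderivative facts for `Q`. -/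
lemma Q_facts (h : ℝ → ℝ) (hc : Continuous h) (hi : Integrable h) :
    (∀ y, HasDerivAt (fun y => ∫ x, h x * Real.sign (x - y)) (-2 * h y) y) ∧
    Tendsto (fun y => ∫ x, h x * Real.sign (x - y)) atTop (𝓝 (-∫ x, h x)) ∧
    Tendsto (fun y => ∫ x, h x * Real.sign (x - y)) atBot (𝓝 (∫ x, h x)) := by
  have key : ∀ y, ∫ x, h x * Real.sign (x - y) =
      (∫ x, h x) - 2 * (∫ x in Set.Iic 0, h x) - 2 * ∫ x in (0:ℝ)..y, h x := by
    intro y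
    have e : (fun x => h x * Real.sign (x - y)) =ᵐ[volume]
        fun x => h x - 2 * (Set.Iic y).indicator h x := by
      filter_upwards [compl_mem_ae_iff.2 (measure_singleton (μ := volume) y)] with x hx
      have hx : x ≠ y := by simpa using hx
      rcases hx.lt_or_gt with hlt | hlt
      · rw [Real.sign_of_neg (by linarith), Set.indicator_of_mem (by simpa using hlt.le)]; ring
      · rw [Real.sign_of_pos (by linarith), Set.indicator_of_notMem (by simpa using hlt)]; ring
    rw [integral_congr_ae e, integral_sub hi ((hi.indicator measurableSet_Iic).const_mul 2),
      integral_const_mul, integral_indicator measurableSet_Iic,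
      ← intervalIntegral.integral_Iic_sub_Iic hi.integrableOn hi.integrableOn]
    ring
  have hsplit : (∫ x in Set.Iic 0, h x) + (∫ x in Set.Ioi 0, h x) = ∫ x, h x :=
    intervalIntegral.integral_Iic_add_Ioi hi.integrableOn hi.integrableOn
  rw [funext key]
  refine ⟨fun y => ?_, ?_, ?_⟩
  · have := (hc.integral_hasStrictDerivAt 0 y).hasDerivAt
    have := (this.const_mul 2).const_sub ((∫ x, h x) - 2 * (∫ x in Set.Iic 0, h x))
    exact this.congr_deriv (by ring)
  · have := intervalIntegral_tendsto_integral_Ioi (0:ℝ) (hi.integrableOn) (tendsto_id (α := ℝ) (x := atTop))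
    have := (this.const_mul 2).const_sub ((∫ x, h x) - 2 * (∫ x in Set.Iic 0, h x))
    convert this using 2
    · simp only [id]
    · linarith
  · have := intervalIntegral_tendsto_integral_Iic (0:ℝ) (hi.integrableOn) (tendsto_id (α := ℝ) (x := atBot))
    have := (this.const_mul 2).const_add ((∫ x, h x) - 2 * (∫ x in Set.Iic 0, h x))
    convert this using 2
    · rw [intervalIntegral.integral_symm]; simp
    · linarith

lemma abs_sign_le (x : ℝ) : ‖Real.sign x‖ ≤ 1 := by
  rcases Real.sign_apply_eq x with h | h | h <;> simp [h]

lemma measurable_real_sign : Measurable Real.sign := by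
  unfold Real.sign
  exact Measurable.ite measurableSet_Iio measurable_const
    (Measurable.ite measurableSet_Ioi measurable_const measurable_const)

/-- The integrand of the skew-inner product, regrouped. -/
noncomputable def f_aux (V q g : ℝ[X]) (p : ℝ × ℝ) : ℝ :=
  (q.eval p.1 * Real.exp (-V.eval p.1)) * (g.eval p.2 * Real.exp (-V.eval p.2)) *
    Real.sign (p.1 - p.2)

lemma skew_facts (V q g : ℝ[X]) (hEven : Even V.natDegree) (hdeg : 2 ≤ V.natDegree)
    (hlc : 0 < V.leadingCoeff) :
    Integrable (fun y => g.eval y * Real.exp (-V.eval y) *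
      ∫ x, q.eval x * Real.exp (-V.eval x) * Real.sign (x - y)) ∧
    skewInner V q g = ∫ y, g.eval y * Real.exp (-V.eval y) *
      ∫ x, q.eval x * Real.exp (-V.eval x) * Real.sign (x - y) := by
  have hq := integrable_poly V q hEven hdeg hlc
  have hg := integrable_poly V g hEven hdeg hlc
  have hF : Integrable (fun p : ℝ × ℝ => f_aux V q g p) (volume.prod volume) := by
    refine (hq.mul_prod hg).mul_bdd (c := 1) (g := fun p : ℝ × ℝ => Real.sign (p.1 - p.2)) ?_ ?_
    · exact (measurable_real_sign.comp (measurable_fst.sub measurable_snd)).aestronglyMeasurable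
    · exact Filter.Eventually.of_forall fun p => abs_sign_le _
  have e : ∀ y, ∫ x, f_aux V q g (x, y) = g.eval y * Real.exp (-V.eval y) *
      ∫ x, q.eval x * Real.exp (-V.eval x) * Real.sign (x - y) := by
    intro y
    rw [← integral_const_mul]
    congr 1
    ext x
    simp only [f_aux]; ring
  constructor
  · have := hF.integral_prod_right
    exact this.congr (Filter.Eventually.of_forall e)
  · rw [← funext e, ← integral_prod_symm _ hF]
    unfold skewInner
    congr 1
    ext p
    simp only [f_aux]
    rw [sub_eq_add_neg (-V.eval p.1), Real.exp_add]; ring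

lemma orth_poly (V q g : ℝ[X]) (hEven : Even V.natDegree) (hdeg : 2 ≤ V.natDegree)
    (hlc : 0 < V.leadingCoeff) (n : ℕ) (hg : g.natDegree < n)
    (horth : ∀ j < n, skewInner V q (X ^ j) = 0) :
    ∫ y, g.eval y * Real.exp (-V.eval y) *
      ∫ x, q.eval x * Real.exp (-V.eval x) * Real.sign (x - y) = 0 := by
  have : ∀ y, g.eval y * Real.exp (-V.eval y) *
      (∫ x, q.eval x * Real.exp (-V.eval x) * Real.sign (x - y)) =
      ∑ j ∈ Finset.range n, g.coeff j * ((X ^ j : ℝ[X]).eval y * Real.exp (-V.eval y) *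
      (∫ x, q.eval x * Real.exp (-V.eval x) * Real.sign (x - y))) := by
    intro y
    rw [eval_eq_sum_range' hg, Finset.sum_mul, Finset.sum_mul]
    refine Finset.sum_congr rfl fun j _ => ?_
    simp; ring
  rw [funext this, integral_finsetSum]
  · refine Finset.sum_eq_zero fun j hj => ?_
    rw [integral_const_mul, ← (skew_facts V q (X ^ j) hEven hdeg hlc).2,
      horth j (Finset.mem_range.1 hj), mul_zero]
  · intro j _
    exact (skew_facts V q (X ^ j) hEven hdeg hlc).1.const_mul _

open Filter Topology

/-- A polynomial of degree at most `2k − 1` that is skew-orthogonal to `y^j` for all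
`0 ≤ j ≤ 2k − 1` must vanish. -/
theorem skew_orthogonal_trivial_kernel
    (V : Polynomial ℝ) (hEven : Even V.natDegree) (hdeg : 2 ≤ V.natDegree)
    (hlc : 0 < V.leadingCoeff) (k : ℕ) (q : Polynomial ℝ)
    (hqdeg : q.degree < (2 * k : ℕ))
    (horth : ∀ j < 2 * k, skewInner V q (X ^ j) = 0) :
    q = 0 := by
  by_contra hq0
  have hqn : q.natDegree < 2 * k := (natDegree_lt_iff_degree_lt hq0).2 hqdeg
  have hqi := integrable_poly V q hEven hdeg hlc
  have hcont : Continuous (fun x => q.eval x * Real.exp (-V.eval x)) := by fun_prop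
  obtain ⟨hder, htop, hbot⟩ := Q_facts _ hcont hqi
  have hint := fun g => (skew_facts V q g hEven hdeg hlc).1
  have horth' := fun g hg => orth_poly V q g hEven hdeg hlc (2 * k) hg horth
  set Q : ℝ → ℝ := fun y => ∫ x, q.eval x * Real.exp (-V.eval x) * Real.sign (x - y) with hQ
  set c := ∫ x, q.eval x * Real.exp (-V.eval x)
  have hQc : Continuous Q := continuous_iff_continuousAt.2 fun y => (hder y).continuousAt
  -- Rolle
  have rolle : ∀ x y, x < y → Q x = Q y → ∃ z ∈ q.roots.toFinset, x < z ∧ z < y := by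
    intro x y hxy hQxy
    obtain ⟨z, hz, h0⟩ := exists_hasDerivAt_eq_zero hxy hQc.continuousOn hQxy (fun z _ => hder z)
    refine ⟨z, ?_, hz.1, hz.2⟩
    simpa [hq0, (Real.exp_pos _).ne'] using h0
  have hroots : q.roots.toFinset.card ≤ q.natDegree :=
    (Multiset.toFinset_card_le _).trans (card_roots' q)
  have hcard : ∀ s : Finset ℝ, (∀ x ∈ s, Q x = 0) → s.card ≤ q.roots.toFinset.card + 1 := by
    intro s hs
    exact Finset.card_le_of_interleaved fun x hx y hy hxy _ =>
      rolle x y hxy (by rw [hs x hx, hs y hy])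
  have hfin : {x | Q x = 0}.Finite := by
    by_contra hinf
    obtain ⟨s, hs, hs'⟩ := Set.Infinite.exists_subset_card_eq hinf (q.roots.toFinset.card + 2)
    have := hcard s (fun x hx => hs hx)
    omega
  obtain ⟨Z, hZ⟩ : ∃ Z : Finset ℝ, ∀ x, x ∈ Z ↔ Q x = 0 :=
    ⟨hfin.toFinset, fun x => by simp⟩
  have hZcard := hcard Z (fun x hx => (hZ x).1 hx)
  obtain ⟨S, hSZ, s, hs⟩ := exists_sign_poly Z Q (signConst_of_continuous hQc Z hZ)
  have hZae : ∀ᵐ x : ℝ, x ∉ Z := by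
    have : volume (Z : Set ℝ) = 0 := Z.finite_toSet.measure_zero _
    exact measure_eq_zero_iff_ae_notMem.1 this
  have hScard : 2 * k ≤ S.card := by
    by_contra hlt
    set g : ℝ[X] := ∏ z ∈ S, (X - C z) with hg
    have hgd : g.natDegree < 2 * k := by
      rw [hg, natDegree_prod_of_monic _ _ (fun z _ => monic_X_sub_C z)]
      simpa using hlt
    have hge : ∀ x, g.eval x = ∏ z ∈ S, (x - z) := by intro x; simp [hg, eval_prod]
    have h0 := horth' g hgd
    have hi := (hint g).const_mul s
    have hpos : ∀ᵐ x : ℝ, 0 < s * (g.eval x * Real.exp (-V.eval x) * Q x) := by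
      filter_upwards [hZae] with x hx
      have := mul_pos (hs x hx) (Real.exp_pos (-V.eval x))
      rw [← hge] at this
      linarith
    have hz : ∫ x, s * (g.eval x * Real.exp (-V.eval x) * Q x) = 0 := by
      rw [integral_const_mul, h0, mul_zero]
    have := (integral_eq_zero_iff_of_nonneg_ae (hpos.mono fun x hx => hx.le) hi).1 hz
    obtain ⟨x, hx1, hx2⟩ := (this.and hpos).exists
    simp only [Pi.zero_apply] at hx1
    linarith
  have hSle := Finset.card_le_card hSZ
  have hSZ' : S = Z := Finset.eq_of_subset_of_card_le hSZ (by omega)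
  subst hSZ'
  have hSc : S.card = 2 * k := by omega
  have hne : S.Nonempty := Finset.card_pos.1 (by omega)
  -- behaviour at both ends
  have htop_pos : ∀ x, S.max' hne < x → 0 < s * Q x := by
    intro x hx
    have hlt : ∀ z ∈ S, z < x := fun z hz => (S.le_max' z hz).trans_lt hx
    have h1 := hs x (fun h => lt_irrefl _ (hlt x h))
    have h2 : 0 < ∏ z ∈ S, (x - z) := Finset.prod_pos fun z hz => sub_pos.2 (hlt z hz)
    exact (mul_pos_iff_of_pos_right h2).1 h1
  have hbot_pos : ∀ x, x < S.min' hne → 0 < s * Q x := by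
    intro x hx
    have hlt : ∀ z ∈ S, x < z := fun z hz => hx.trans_le (S.min'_le z hz)
    have h1 := hs x (fun h => lt_irrefl _ (hlt x h))
    have h2 : 0 < ∏ z ∈ S, (x - z) := by
      have : ∏ z ∈ S, (x - z) = ∏ z ∈ S, (z - x) := by
        rw [← Finset.prod_congr rfl (fun z _ => neg_sub z x), Finset.prod_neg, hSc]
        simp
      rw [this]
      exact Finset.prod_pos fun z hz => sub_pos.2 (hlt z hz)
    exact (mul_pos_iff_of_pos_right h2).1 h1
  have hc1 : 0 ≤ s * -c := ge_of_tendsto (htop.const_mul s)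
    ((eventually_gt_atTop (S.max' hne)).mono fun x hx => (htop_pos x hx).le)
  have hc2 : 0 ≤ s * c := ge_of_tendsto (hbot.const_mul s)
    ((eventually_lt_atBot (S.min' hne)).mono fun x hx => (hbot_pos x hx).le)
  have hsc : s * -c = 0 := by linarith
  set m := S.max' hne with hm
  have hQm : Q m = 0 := (hZ m).1 (S.max'_mem hne)
  have htop' := htop.const_mul s
  rw [hsc] at htop'
  have hy := htop_pos (m + 1) (by linarith)
  obtain ⟨t, ht1, ht2⟩ := ((htop'.eventually_lt_const hy).and (eventually_gt_atTop (m + 1))).exists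
  have htp := htop_pos t (by linarith)
  obtain ⟨r, hr, hr'⟩ := intermediate_value_Icc (show m ≤ m + 1 by linarith)
    (f := fun x => s * Q x) (by fun_prop)
    (show s * Q t ∈ Set.Icc (s * Q m) (s * Q (m + 1)) by
      rw [hQm, mul_zero]; exact ⟨htp.le, ht1.le⟩)
  have hs0 : s ≠ 0 := by rintro rfl; simp at hy
  have hQrt : Q r = Q t := mul_left_cancel₀ hs0 hr'
  obtain ⟨w, hw, hrw, -⟩ := rolle r t (by linarith [hr.2]) hQrt
  have hmw : m < w := hr.1.trans_lt hrw
  have hfinal : S.card ≤ (q.roots.toFinset.erase w).card + 1 :=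
    Finset.card_le_of_interleaved fun x hx y hy hxy _ => by
      obtain ⟨z, hz, h1, h2⟩ := rolle x y hxy (by rw [(hZ x).1 hx, (hZ y).1 hy])
      refine ⟨z, Finset.mem_erase.2 ⟨?_, hz⟩, h1, h2⟩
      have := S.le_max' y hy
      exact (by linarith : z < w).ne
  rw [Finset.card_erase_of_mem hw] at hfinal
  have := Finset.card_pos.2 ⟨w, hw⟩
  omega
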